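/- arXiv:2203.02002 — 5 statements merged into one kernel-verified Lean document; each statement's English description precedes it below -/
import Mathlib

section
/- Let N > z0 > 0, α ∈ [0,1), λ ∈ (0,1), z1max := (N−z0)/(1+α), and d := 1 − λ − α·λ. If d > 0, then z1* := min(z1max, λ·z0/d) minimises the objective (x̄*_{z0,α}(z1) − λ)² over z1 ∈ [0, z1max], where x̄*_{z0,α}(z1) = z1/(z0+(1+α)·z1); that is, for every z1 ∈ [0, z1max], (x̄*_{z0,α}(z1*) − λ)² ≤ (x̄*_{z0,α}(z1) − λ)². -/
/-- Let `N > z0 > 0`, `α ∈ [0,1)`, `λ ∈ (0,1)`, `z1max := (N−z0)/(1+α)` and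
`d := 1 − λ − α·λ > 0`. Then `z1* := min(z1max, λ·z0/d)` minimises
`(x̄*_{z0,α}(z1) − λ)²` over `z1 ∈ [0, z1max]`, where `x̄*_{z0,α}(z1) = z1/(z0+(1+α)·z1)`. -/
theorem stmt_4 (N z0 α lam : ℝ) (hz0 : 0 < z0) (hN : z0 < N)
    (hα : α ∈ Set.Ico (0:ℝ) 1) (hlam : lam ∈ Set.Ioo (0:ℝ) 1)
    (z1max d : ℝ) (hz1max : z1max = (N - z0) / (1 + α))
    (hd : d = 1 - lam - α * lam) (hdpos : 0 < d) :
    ∀ z1 ∈ Set.Icc (0:ℝ) z1max,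
      (min z1max (lam * z0 / d) / (z0 + (1 + α) * min z1max (lam * z0 / d)) - lam) ^ 2 ≤
        (z1 / (z0 + (1 + α) * z1) - lam) ^ 2 := by
  rintro z1 ⟨hz1, hz1le⟩
  have hα1 : 0 < 1 + α := by linarith [hα.1]
  have hden : ∀ x : ℝ, 0 ≤ x → 0 < z0 + (1 + α) * x := fun x hx => by positivity
  rcases le_total z1max (lam * z0 / d) with h | h
  · rw [min_eq_left h]
    have hm : 0 ≤ z1max := hz1.trans hz1le
    have hmono : z1 / (z0 + (1 + α) * z1) ≤ z1max / (z0 + (1 + α) * z1max) := by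
      rw [div_le_div_iff₀ (hden z1 hz1) (hden z1max hm)]
      linarith [mul_le_mul_of_nonneg_right hz1le hz0.le]
    have hle : z1max / (z0 + (1 + α) * z1max) ≤ lam := by
      rw [div_le_iff₀ (hden z1max hm)]
      rw [le_div_iff₀ hdpos, hd] at h
      linarith
    rw [← neg_sq, ← neg_sq (z1 / _ - lam)]
    exact pow_le_pow_left₀ (by linarith) (by linarith) 2
  · rw [min_eq_right h]
    have hx : 0 ≤ lam * z0 / d := div_nonneg (mul_nonneg hlam.1.le hz0.le) hdpos.le
    have heq : lam * z0 / d / (z0 + (1 + α) * (lam * z0 / d)) = lam := by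
      rw [div_eq_iff (hden _ hx).ne']
      have hmul : lam * z0 / d * d = lam * z0 := div_mul_cancel₀ _ hdpos.ne'
      rw [hd] at hmul ⊢
      linarith
    rw [heq, sub_self, zero_pow two_ne_zero]
    positivity
end

section
/- Let z0 > 0, α ∈ [0,1), λ ∈ (0,1), and suppose d := 1 − λ − α·λ ≤ 0. Then the function z1 ↦ (x̄*_{z0,α}(z1) − λ)², with x̄*_{z0,α}(z1) = z1/(z0+(1+α)·z1), is strictly decreasing on [0,∞); consequently for any z1max > 0 its unique minimiser over [0, z1max] is z1max, and it has no minimiser over [0,∞). -/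
/-- Let `z0 > 0`, `α ∈ [0,1)`, `λ ∈ (0,1)` with `d := 1 − λ − α·λ ≤ 0`. Then
`z1 ↦ (z1/(z0+(1+α)·z1) − λ)²` is strictly decreasing on `[0,∞)`; consequently for any
`z1max > 0` its unique minimiser over `[0, z1max]` is `z1max`, and it has no minimiser
over `[0,∞)`. -/
theorem stmt_5 (z0 α lam : ℝ) (hz0 : 0 < z0) (hα : α ∈ Set.Ico (0:ℝ) 1)
    (hlam : lam ∈ Set.Ioo (0:ℝ) 1)
    (d : ℝ) (hd : d = 1 - lam - α * lam) (hdle : d ≤ 0) :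
    StrictAntiOn (fun z1 : ℝ => (z1 / (z0 + (1 + α) * z1) - lam) ^ 2) (Set.Ici 0) ∧
    (∀ z1max : ℝ, 0 < z1max →
      (∀ z1 ∈ Set.Icc (0:ℝ) z1max,
        (z1max / (z0 + (1 + α) * z1max) - lam) ^ 2 ≤
          (z1 / (z0 + (1 + α) * z1) - lam) ^ 2) ∧
      (∀ z ∈ Set.Icc (0:ℝ) z1max,
        (∀ z1 ∈ Set.Icc (0:ℝ) z1max,
          (z / (z0 + (1 + α) * z) - lam) ^ 2 ≤ (z1 / (z0 + (1 + α) * z1) - lam) ^ 2) →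
        z = z1max)) ∧
    ¬ ∃ z ∈ Set.Ici (0:ℝ), ∀ z1 ∈ Set.Ici (0:ℝ),
        (z / (z0 + (1 + α) * z) - lam) ^ 2 ≤ (z1 / (z0 + (1 + α) * z1) - lam) ^ 2 := by
  have hanti : StrictAntiOn (fun z1 : ℝ => (z1 / (z0 + (1 + α) * z1) - lam) ^ 2)
      (Set.Ici 0) := by
    intro x hx y hy hxy
    have hx0 : 0 ≤ x := hx
    have hy0 : 0 ≤ y := hy
    have hα1 : 0 ≤ 1 + α := by linarith [hα.1]
    have hdx : 0 < z0 + (1 + α) * x := by positivity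
    have hdy : 0 < z0 + (1 + α) * y := by positivity
    have hlt : x / (z0 + (1 + α) * x) < y / (z0 + (1 + α) * y) := by
      rw [div_lt_div_iff₀ hdx hdy]
      linarith [mul_lt_mul_of_pos_right hxy hz0]
    have hlt_lam : y / (z0 + (1 + α) * y) < lam := by
      rw [div_lt_iff₀ hdy]
      have hdy_nonpos : (1 - lam - α * lam) * y ≤ 0 :=
        mul_nonpos_of_nonpos_of_nonneg (hd ▸ hdle) hy0
      linarith [mul_pos hlam.1 hz0]
    rw [sq_lt_sq, abs_of_neg (by linarith), abs_of_neg (by linarith)]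
    linarith
  refine ⟨hanti, fun z1max hpos => ⟨fun z1 hz1 => ?_, fun z hz hmin => ?_⟩, ?_⟩
  · exact hanti.antitoneOn hz1.1 hpos.le hz1.2
  · refine hz.2.eq_or_lt.resolve_right fun hlt => ?_
    exact (hmin z1max ⟨hpos.le, le_rfl⟩).not_gt (hanti hz.1 hpos.le hlt)
  · rintro ⟨z, hz, hmin⟩
    have hz' : z + 1 ∈ Set.Ici (0 : ℝ) := Set.mem_Ici.2 (add_nonneg hz zero_le_one)
    exact (hmin (z + 1) hz').not_gt (hanti hz hz' (lt_add_one z))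
end

section
/- Let z0 > 0 and α ∈ [0,1). The function σ_{z0,α}(z1) = 4·(z0+α·z1)·z1/(z0+(1+α)·z1)² is strictly increasing on the interval [0, z0/(1−α)]. -/
/-- Let `z0 > 0` and `α ∈ [0,1)`. The function
`σ_{z0,α}(z1) = 4·(z0+α·z1)·z1/(z0+(1+α)·z1)²` is strictly increasing on the interval
`[0, z0/(1−α)]`. -/
theorem stmt_7 (z0 α : ℝ) (hz0 : 0 < z0) (hα : α ∈ Set.Ico (0:ℝ) 1) :
    StrictMonoOn (fun z1 : ℝ => 4 * (z0 + α * z1) * z1 / (z0 + (1 + α) * z1) ^ 2)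
      (Set.Icc 0 (z0 / (1 - α))) := by
  obtain ⟨hα0, hα1⟩ := hα
  have hpos : ∀ z : ℝ, 0 ≤ z → 0 < z0 + (1 + α) * z := fun z hz => by positivity
  have hsq : ∀ z : ℝ, 0 ≤ z → 4 * (z0 + α * z) * z / (z0 + (1 + α) * z) ^ 2 =
      1 - ((z0 - (1 - α) * z) / (z0 + (1 + α) * z)) ^ 2 := fun z hz => by
    have := (hpos z hz).ne'
    field_simp
    ring
  rintro x ⟨hx, -⟩ y ⟨hy, hy'⟩ hxy
  rw [le_div_iff₀ (by linarith)] at hy'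
  have hnonneg : 0 ≤ (z0 - (1 - α) * y) / (z0 + (1 + α) * y) :=
    div_nonneg (by linarith) (hpos y hy).le
  have hlt : (z0 - (1 - α) * y) / (z0 + (1 + α) * y) <
      (z0 - (1 - α) * x) / (z0 + (1 + α) * x) := by
    rw [div_lt_div_iff₀ (hpos y hy) (hpos x hx)]
    nlinarith [mul_pos hz0 (sub_pos.2 hxy)]
  simp only [hsq x hx, hsq y hy]
  exact sub_lt_sub_left (pow_lt_pow_left₀ hlt hnonneg two_ne_zero) 1
end

section
/- Let N > z0 > 0, α ∈ [0,1), and z1max := (N−z0)/(1+α). Then z1* := min(z1max, z0/(1−α)) maximises σ_{z0,α}(z1) = 4·(z0+α·z1)·z1/(z0+(1+α)·z1)² over the interval [0, z1max]; that is, σ_{z0,α}(z1*) ≥ σ_{z0,α}(z1) for every z1 ∈ [0, z1max]. -/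
/-- The opinion diversity is monotone up to the point where both opinions are balanced. -/
theorem diversity_le_of_le {z0 α x y : ℝ} (hz0 : 0 < z0) (hα : 0 ≤ α) (hα1 : α < 1)
    (hx : 0 ≤ x) (hxy : x ≤ y) (hy : (1 - α) * y ≤ z0) :
    4 * (z0 + α * x) * x / (z0 + (1 + α) * x) ^ 2 ≤
      4 * (z0 + α * y) * y / (z0 + (1 + α) * y) ^ 2 := by
  have hy0 : 0 ≤ y := hx.trans hxy
  have hBx : 0 < z0 + (1 + α) * x := by positivity
  have hBy : 0 < z0 + (1 + α) * y := by positivity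
  have hux : 0 ≤ z0 - (1 - α) * x := by
    linarith [mul_le_mul_of_nonneg_left hxy (sub_nonneg.2 hα1.le)]
  have huy : 0 ≤ z0 - (1 - α) * y := sub_nonneg.2 hy
  rw [div_le_div_iff₀ (by positivity) (by positivity)]
  have h : 0 ≤ 2 * z0 * (y - x) * ((z0 - (1 - α) * x) * (z0 + (1 + α) * y) +
      (z0 - (1 - α) * y) * (z0 + (1 + α) * x)) :=
    mul_nonneg (mul_nonneg (by positivity) (sub_nonneg.2 hxy)) (by positivity)
  linear_combination h

/-- The opinion diversity is maximal where both opinions are balanced. -/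
theorem diversity_le_of_balanced {z0 α x y : ℝ} (hz0 : 0 < z0) (hα : 0 ≤ α)
    (hx : 0 ≤ x) (hy0 : 0 ≤ y) (hy : (1 - α) * y = z0) :
    4 * (z0 + α * x) * x / (z0 + (1 + α) * x) ^ 2 ≤
      4 * (z0 + α * y) * y / (z0 + (1 + α) * y) ^ 2 := by
  have hBx : 0 < z0 + (1 + α) * x := by positivity
  have hBy : 0 < z0 + (1 + α) * y := by positivity
  have h : 4 * (z0 + α * y) * y / (z0 + (1 + α) * y) ^ 2 = 1 := by
    rw [div_eq_one_iff_eq (by positivity), ← hy]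
    ring
  rw [h, div_le_one (by positivity)]
  linear_combination sq_nonneg (z0 - (1 - α) * x)

/-- Let `N > z0 > 0`, `α ∈ [0,1)` and `z1max := (N−z0)/(1+α)`. Then
`z1* := min(z1max, z0/(1−α))` maximises `σ_{z0,α}(z1) = 4·(z0+α·z1)·z1/(z0+(1+α)·z1)²`
over `[0, z1max]`. -/
theorem stmt_8 (N z0 α : ℝ) (hz0 : 0 < z0) (hN : z0 < N) (hα : α ∈ Set.Ico (0:ℝ) 1)
    (z1max : ℝ) (hz1max : z1max = (N - z0) / (1 + α)) :
    ∀ z1 ∈ Set.Icc (0:ℝ) z1max,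
      4 * (z0 + α * z1) * z1 / (z0 + (1 + α) * z1) ^ 2 ≤
        4 * (z0 + α * min z1max (z0 / (1 - α))) * min z1max (z0 / (1 - α)) /
          (z0 + (1 + α) * min z1max (z0 / (1 - α))) ^ 2 := by
  rintro x ⟨hx0, hx⟩
  obtain ⟨hα0, hα1⟩ := hα
  have h1 : 0 < 1 - α := sub_pos.2 hα1
  rcases le_total z1max (z0 / (1 - α)) with h | h
  · rw [min_eq_left h]
    exact diversity_le_of_le hz0 hα0 hα1 hx0 hx ((le_div_iff₀' h1).1 h)
  · rw [min_eq_right h]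
    exact diversity_le_of_balanced hz0 hα0 hx0 (by positivity) (mul_div_cancel₀ z0 h1.ne')
end

section
/- Let ℱ be a finite index set, let w : ℱ × ℱ → ℝ be nonnegative with w_{ii} = 0 for all i, let z0, z1 : ℱ → ℝ be nonnegative with z0_i + z1_i > 0 for every i, set d_i = Σ_{j∈ℱ} w_{ij} + z0_i + z1_i, and suppose x : ℱ → ℝ satisfies x_i = (Σ_{j∈ℱ} w_{ij}·x_j + z1_i)/d_i for every i ∈ ℱ. Then 0 ≤ x_i ≤ 1 for every i ∈ ℱ. -/
/-- Discrete minimum principle: a solution of a strictly diagonally dominant system with nonnegative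
influences `w` and nonnegative source `b` is nonnegative. -/
theorem nonneg_of_weighted_average {ι : Type*} [Fintype ι]
    (w : ι → ι → ℝ) (hw : ∀ i j, 0 ≤ w i j) (c b : ι → ℝ) (hc : ∀ i, 0 < c i)
    (hb : ∀ i, 0 ≤ b i) (x : ι → ℝ)
    (hx : ∀ i, x i * (∑ j, w i j + c i) = ∑ j, w i j * x j + b i) (i : ι) : 0 ≤ x i := by
  have : Nonempty ι := ⟨i⟩
  obtain ⟨m, hm⟩ := Finite.exists_min x
  refine le_trans ?_ (hm i)
  have hsum : (∑ j, w m j) * x m ≤ ∑ j, w m j * x j := by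
    rw [Finset.sum_mul]
    exact Finset.sum_le_sum fun j _ => mul_le_mul_of_nonneg_left (hm j) (hw m j)
  have hprod : 0 ≤ x m * c m := by linarith [hx m, hb m]
  exact nonneg_of_mul_nonneg_left hprod (hc m)

/-- If `x` satisfies the equilibrium fixed-point relations
`x_i = (Σ_j w_{ij}·x_j + z1_i)/d_i` with nonnegative weights and zealot influences,
`z0_i + z1_i > 0` and `d_i = Σ_j w_{ij} + z0_i + z1_i`, then `0 ≤ x_i ≤ 1` for every
free user `i`. -/
theorem stmt_16 {ι : Type*} [Fintype ι]
    (w : ι → ι → ℝ) (hw : ∀ i j, 0 ≤ w i j) (hwii : ∀ i, w i i = 0)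
    (z0 z1 : ι → ℝ) (hz0 : ∀ i, 0 ≤ z0 i) (hz1 : ∀ i, 0 ≤ z1 i)
    (hz : ∀ i, 0 < z0 i + z1 i)
    (d : ι → ℝ) (hd : ∀ i, d i = ∑ j, w i j + z0 i + z1 i)
    (x : ι → ℝ) (hx : ∀ i, x i = ((∑ j, w i j * x j) + z1 i) / d i) :
    ∀ i, 0 ≤ x i ∧ x i ≤ 1 := by
  have key : ∀ i, x i * (∑ j, w i j + (z0 i + z1 i)) = ∑ j, w i j * x j + z1 i := by
    intro i
    have hpos : 0 < d i := by
      rw [hd]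
      linarith [hz i, Finset.sum_nonneg fun j (_ : j ∈ Finset.univ) => hw i j]
    rw [← add_assoc, ← hd]
    exact (eq_div_iff hpos.ne').mp (hx i)
  intro i
  refine ⟨nonneg_of_weighted_average w hw _ z1 hz hz1 x key i, ?_⟩
  refine sub_nonneg.mp
    (nonneg_of_weighted_average w hw _ z0 hz hz0 (fun j => 1 - x j) (fun k => ?_) i)
  simp only [mul_sub, mul_one, Finset.sum_sub_distrib]
  linarith [key k]
end
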